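/- Normal natural deduction: in the ∨-free fragment, if Γ ⊢ C↑ has an NJ derivation not using the switch rule [S] (a normal derivation), then ⊢ lft(Γ), rght(C) is B-provable from ℛ_nj \ {Id2}, and conversely; hence removing Id2 from the encoding exactly captures normal proofs. -/

import Mathlib

/-- Expressions of PSF: atoms, additive and multiplicative units and connectives. -/
inductive Expr (α : Type) : Type
  | atom : α → Expr α
  | zero : Expr α
  | one : Expr α
  | plus : Expr α → Expr α → Expr α
  | times : Expr α → Expr α → Expr α

/-- Rules of PSF: expressions extended with `↦` and `⇛`. -/
inductive Rule (α : Type) : Type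
  | atom : α → Rule α
  | zero : Rule α
  | one : Rule α
  | plus : Rule α → Rule α → Rule α
  | times : Rule α → Rule α → Rule α
  | mapsto : Rule α → Expr α → Rule α
  | bigMapsto : Rule α → Expr α → Rule α

/-- Every expression is a rule. -/
def Expr.toRule {α : Type} : Expr α → Rule α
  | .atom a => .atom a
  | .zero => .zero
  | .one => .one
  | .plus e1 e2 => .plus e1.toRule e2.toRule
  | .times e1 e2 => .times e1.toRule e2.toRule

/-- Elements of the right-hand side of a sequent: expressions and debts `Ā`. -/
inductive RElem (α : Type) : Type
  | expr : Expr α → RElem α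
  | debt : α → RElem α

/-- A bias assignment takes values in {-2,-1,+1,+2}. -/
def BiasOK {α : Type} (δ : α → ℤ) : Prop :=
  ∀ a, δ a = -2 ∨ δ a = -1 ∨ δ a = 1 ∨ δ a = 2

/-- An atom is in the classical realm if its bias is ±2. -/
def InClassical {α : Type} (δ : α → ℤ) (a : α) : Prop := δ a = 2 ∨ δ a = -2

/-- `Υ`: a multiset consisting only of classical-realm atoms. -/
def Ups {α : Type} (δ : α → ℤ) (Υ : Multiset (RElem α)) : Prop :=
  ∀ x ∈ Υ, ∃ a, x = RElem.expr (Expr.atom a) ∧ InClassical δ a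

/-- The basic proof system `B` of PSF, with sequents `Γ ⊢ Δ`,
parameterized by the fixed rule set `R` and the bias assignment `δ`. -/
inductive B {α : Type} (R : Set (Rule α)) (δ : α → ℤ) :
    Multiset (Rule α) → Multiset (RElem α) → Prop
  | rzero (Γ Δ) : B R δ Γ (.expr .zero ::ₘ Δ)
  | rplus {Γ Δ E1 E2} : B R δ Γ (.expr E1 ::ₘ Δ) → B R δ Γ (.expr E2 ::ₘ Δ) →
      B R δ Γ (.expr (E1.plus E2) ::ₘ Δ)
  | rone {Γ Δ} : B R δ Γ Δ → B R δ Γ (.expr .one ::ₘ Δ)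
  | rtimes {Γ Δ E1 E2} : B R δ Γ (.expr E1 ::ₘ .expr E2 ::ₘ Δ) →
      B R δ Γ (.expr (E1.times E2) ::ₘ Δ)
  | lone : B R δ {Rule.one} 0
  | lplusL {Γ Δ R1 R2} : B R δ (R1 ::ₘ Γ) Δ → B R δ (Rule.plus R1 R2 ::ₘ Γ) Δ
  | lplusR {Γ Δ R1 R2} : B R δ (R2 ::ₘ Γ) Δ → B R δ (Rule.plus R1 R2 ::ₘ Γ) Δ
  | ltimes {Γ1 Γ2 Δ1 Δ2 R1 R2} : B R δ (R1 ::ₘ Γ1) Δ1 → B R δ (R2 ::ₘ Γ2) Δ2 →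
      B R δ (Rule.times R1 R2 ::ₘ (Γ1 + Γ2)) (Δ1 + Δ2)
  | lmapsto {Γ1 Γ2 Δ1 Δ2 R1 E} : B R δ (R1 ::ₘ Γ1) Δ1 → B R δ Γ2 (.expr E ::ₘ Δ2) →
      B R δ (Rule.mapsto R1 E ::ₘ (Γ1 + Γ2)) (Δ1 + Δ2)
  | lbigMapsto {Γ Δ Υ R1 E} : Ups δ Υ → B R δ {R1} Υ → B R δ Γ (.expr E ::ₘ Δ) →
      B R δ (Rule.bigMapsto R1 E ::ₘ Γ) (Υ + Δ)
  | decide {Γ Δ} : Γ ≠ 0 → (∀ r ∈ Γ, r ∈ R) → B R δ Γ Δ → B R δ 0 Δ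
  | debit1 {Γ Δ A} : δ A = 1 → B R δ Γ (.debt A ::ₘ Δ) → B R δ (Rule.atom A ::ₘ Γ) Δ
  | debit2 {Υ A} : δ A = 2 → Ups δ Υ → B R δ 0 (.debt A ::ₘ Υ) → B R δ {Rule.atom A} Υ
  | init {E} : B R δ {E.toRule} {.expr E}
  | initd {A} : B R δ 0 {.debt A, .expr (.atom A)}
  | contrR {Γ Δ S} : InClassical δ S →
      B R δ Γ (.expr (.atom S) ::ₘ .expr (.atom S) ::ₘ Δ) →
      B R δ Γ (.expr (.atom S) ::ₘ Δ)
  | weakR {Γ Δ S} : InClassical δ S → B R δ Γ Δ → B R δ Γ (.expr (.atom S) ::ₘ Δ)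

/-- Propositional formulas over `⊃`, `∧`, `∨`, `⊤`, `⊥`. -/
inductive Form : Type
  | atom : ℕ → Form
  | imp : Form → Form → Form
  | and : Form → Form → Form
  | or : Form → Form → Form
  | top : Form
  | bot : Form
deriving DecidableEq

/-- Tagged atoms: formulas occurring at the top (`lft`) or at the bottom
(`rght`) of a sheet. -/
inductive TAtom : Type
  | lft : Form → TAtom
  | rght : Form → TAtom

/-- Bidirectional natural deduction NJ: `NJ Γ C true` is the judgment
`Γ ⊢ C↑` and `NJ Γ C false` is `Γ ⊢ C↓`. -/
inductive NJ : Finset Form → Form → Bool → Prop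
  | impE {Γ : Finset Form} {A B : Form} : NJ Γ (A.imp B) false → NJ Γ A true → NJ Γ B false
  | impI {Γ : Finset Form} {A B : Form} : NJ (insert A Γ) B true → NJ Γ (A.imp B) true
  | andE1 {Γ : Finset Form} {A B : Form} : NJ Γ (A.and B) false → NJ Γ A false
  | andE2 {Γ : Finset Form} {A B : Form} : NJ Γ (A.and B) false → NJ Γ B false
  | andI {Γ : Finset Form} {A B : Form} : NJ Γ A true → NJ Γ B true → NJ Γ (A.and B) true
  | id {Γ : Finset Form} {A : Form} : A ∈ Γ → NJ Γ A false
  | M {Γ : Finset Form} {A : Form} : NJ Γ A false → NJ Γ A true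
  | S {Γ : Finset Form} {A : Form} : NJ Γ A true → NJ Γ A false
  | topI {Γ : Finset Form} : NJ Γ Form.top true
  | botE {Γ : Finset Form} {C : Form} : NJ Γ Form.bot false → NJ Γ C true
  | orE {Γ : Finset Form} {A B C : Form} {d : Bool} : NJ Γ (A.or B) false →
      NJ (insert A Γ) C d → NJ (insert B Γ) C d → NJ Γ C d
  | orI1 {Γ : Finset Form} {A B : Form} : NJ Γ A true → NJ Γ (A.or B) true
  | orI2 {Γ : Finset Form} {A B : Form} : NJ Γ B true → NJ Γ (A.or B) true

/-- Membership in the rule set of Figure 3 (encoding the introduction and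
elimination rules together with `Id1` and `Id2`). -/
inductive InRnj : Rule TAtom → Prop
  | impL (A B : Form) : InRnj (Rule.bigMapsto
      (Rule.mapsto (Rule.atom (TAtom.lft (A.imp B))) (Expr.atom (TAtom.rght A)))
      (Expr.atom (TAtom.lft B)))
  | impR (A B : Form) : InRnj (Rule.mapsto (Rule.atom (TAtom.rght (A.imp B)))
      (Expr.times (Expr.atom (TAtom.lft A)) (Expr.atom (TAtom.rght B))))
  | andL1 (A B : Form) : InRnj (Rule.mapsto (Rule.atom (TAtom.lft (A.and B)))
      (Expr.atom (TAtom.lft A)))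
  | andL2 (A B : Form) : InRnj (Rule.mapsto (Rule.atom (TAtom.lft (A.and B)))
      (Expr.atom (TAtom.lft B)))
  | andR (A B : Form) : InRnj (Rule.mapsto (Rule.atom (TAtom.rght (A.and B)))
      (Expr.plus (Expr.atom (TAtom.rght A)) (Expr.atom (TAtom.rght B))))
  | orL (A B : Form) : InRnj (Rule.mapsto (Rule.atom (TAtom.lft (A.or B)))
      (Expr.plus (Expr.atom (TAtom.lft A)) (Expr.atom (TAtom.lft B))))
  | orR1 (A B : Form) : InRnj (Rule.mapsto (Rule.atom (TAtom.rght (A.or B)))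
      (Expr.atom (TAtom.rght A)))
  | orR2 (A B : Form) : InRnj (Rule.mapsto (Rule.atom (TAtom.rght (A.or B)))
      (Expr.atom (TAtom.rght B)))
  | botL : InRnj (Rule.mapsto (Rule.atom (TAtom.lft Form.bot)) Expr.zero)
  | topR : InRnj (Rule.mapsto (Rule.atom (TAtom.rght Form.top)) Expr.zero)
  | id1 (C : Form) : InRnj (Rule.times (Rule.atom (TAtom.lft C))
      (Rule.atom (TAtom.rght C)))
  | id2 (C : Form) : InRnj (Rule.bigMapsto
      (Rule.mapsto Rule.one (Expr.atom (TAtom.rght C)))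
      (Expr.atom (TAtom.lft C)))

/-- The rule set `ℛ_nj` of Figure 3. -/
def Rnj : Set (Rule TAtom) := { r | InRnj r }

/-- The bias assignment for natural deduction:
`δ(lft ·) = +2` and `δ(rght ·) = −1`. -/
def njBias : TAtom → ℤ
  | .lft _ => 2
  | .rght _ => -1

/-- The encoding of the judgment `Γ ⊢ C↑` as the sequent `⊢ lft(Γ), rght(C)`. -/
def encUp (Γ : Finset Form) (C : Form) : Multiset (RElem TAtom) :=
  Γ.val.map (fun A => RElem.expr (Expr.atom (TAtom.lft A))) +
    {RElem.expr (Expr.atom (TAtom.rght C))}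

/-- The encoding of the judgment `Γ ⊢ C↓` as the sequent `⊢ lft(Γ), lft(C)‾`. -/
def encDown (Γ : Finset Form) (C : Form) : Multiset (RElem TAtom) :=
  Γ.val.map (fun A => RElem.expr (Expr.atom (TAtom.lft A))) +
    {RElem.debt (TAtom.lft C)}

/-- A formula is ∨-free. -/
def OrFree : Form → Prop
  | .atom _ => True
  | .imp A B => OrFree A ∧ OrFree B
  | .and A B => OrFree A ∧ OrFree B
  | .or _ _ => False
  | .top => True
  | .bot => True

/-- Normal natural deduction for the ∨-free fragment (`⊃`, `∧`, `⊤`, `⊥`):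
the rules of Figure 4 with no occurrence of the switch rule `[S]`. -/
inductive NJn : Finset Form → Form → Bool → Prop
  | impE {Γ : Finset Form} {A B : Form} :
      NJn Γ (A.imp B) false → NJn Γ A true → NJn Γ B false
  | impI {Γ : Finset Form} {A B : Form} :
      NJn (insert A Γ) B true → NJn Γ (A.imp B) true
  | andE1 {Γ : Finset Form} {A B : Form} : NJn Γ (A.and B) false → NJn Γ A false
  | andE2 {Γ : Finset Form} {A B : Form} : NJn Γ (A.and B) false → NJn Γ B false
  | andI {Γ : Finset Form} {A B : Form} :
      NJn Γ A true → NJn Γ B true → NJn Γ (A.and B) true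
  | id {Γ : Finset Form} {A : Form} : A ∈ Γ → NJn Γ A false
  | M {Γ : Finset Form} {A : Form} : NJn Γ A false → NJn Γ A true
  | topI {Γ : Finset Form} : NJn Γ Form.top true
  | botE {Γ : Finset Form} {C : Form} : NJn Γ Form.bot false → NJn Γ C true

/-- The rule set `ℛ_nj \ {Id2}`. -/
def Rnj' : Set (Rule TAtom) :=
  { r | InRnj r ∧ ∀ C : Form, r ≠ Rule.bigMapsto
      (Rule.mapsto Rule.one (Expr.atom (TAtom.rght C)))
      (Expr.atom (TAtom.lft C)) }

open scoped Pointwise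

/-! ### From normal derivations to `B`-proofs -/

/-- The multiset of right-hand side atoms `lft(Γ)`. -/
def lftCtx (Γ : Multiset Form) : Multiset (RElem TAtom) :=
  Γ.map fun A => RElem.expr (Expr.atom (TAtom.lft A))

theorem lftCtx_cons (A : Form) (Γ : Multiset Form) :
    lftCtx (A ::ₘ Γ) = RElem.expr (Expr.atom (TAtom.lft A)) ::ₘ lftCtx Γ :=
  Multiset.map_cons _ _ _

theorem inClassical_lft (A : Form) : InClassical njBias (TAtom.lft A) := Or.inl rfl

theorem ups_lftCtx (Γ : Multiset Form) : Ups njBias (lftCtx Γ) := by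
  intro x hx
  obtain ⟨A, -, rfl⟩ := Multiset.mem_map.1 hx
  exact ⟨_, rfl, inClassical_lft A⟩

theorem B.weaken_lftCtx {R : Set (Rule TAtom)} {G : Multiset (Rule TAtom)}
    {Δ : Multiset (RElem TAtom)} (h : B R njBias G Δ) (Γ : Multiset Form) :
    B R njBias G (lftCtx Γ + Δ) := by
  induction Γ using Multiset.induction_on with
  | empty => simpa [lftCtx] using h
  | cons A Γ ih =>
    rw [lftCtx_cons, Multiset.cons_add]
    exact B.weakR (inClassical_lft A) ih

theorem B.contract_lftCtx {R : Set (Rule TAtom)} {G : Multiset (Rule TAtom)}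
    {Γ : Multiset Form} {Δ : Multiset (RElem TAtom)}
    (h : B R njBias G (lftCtx Γ + lftCtx Γ + Δ)) : B R njBias G (lftCtx Γ + Δ) := by
  induction Γ using Multiset.induction_on generalizing Δ with
  | empty => simpa [lftCtx] using h
  | cons A Γ ih =>
    rw [lftCtx_cons] at h ⊢
    rw [Multiset.cons_add]
    refine B.contrR (inClassical_lft A) ?_
    have := @ih (.expr (.atom (.lft A)) ::ₘ .expr (.atom (.lft A)) ::ₘ Δ)
    simp only [Multiset.cons_add, Multiset.add_cons] at h this ⊢
    exact this h

theorem B.decide_one {R : Set (Rule TAtom)} {r : Rule TAtom} {Δ : Multiset (RElem TAtom)}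
    (hr : r ∈ R) (h : B R njBias {r} Δ) : B R njBias 0 Δ :=
  B.decide (Multiset.singleton_ne_zero r) (by simpa using hr) h

theorem B.mapsto_one {R : Set (Rule TAtom)} {r : Rule TAtom} {E : Expr TAtom}
    {Δ₁ Δ₂ : Multiset (RElem TAtom)} (h₁ : B R njBias {r} Δ₁)
    (h₂ : B R njBias 0 (.expr E ::ₘ Δ₂)) :
    B R njBias {Rule.mapsto r E} (Δ₁ + Δ₂) :=
  B.lmapsto (Γ1 := 0) (Γ2 := 0) h₁ h₂

theorem B.debit_lft {R : Set (Rule TAtom)} {Γ : Multiset Form} {A : Form}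
    (h : B R njBias 0 (lftCtx Γ + {.debt (.lft A)})) :
    B R njBias {Rule.atom (.lft A)} (lftCtx Γ) := by
  refine B.debit2 rfl (ups_lftCtx Γ) ?_
  rwa [← Multiset.singleton_add, add_comm]

/-- Decide on a rule `rght C ↦ E` when `rght C` is available. -/
theorem B.decide_rght {R : Set (Rule TAtom)} {C : Form} {E : Expr TAtom}
    {Δ : Multiset (RElem TAtom)}
    (hr : Rule.mapsto (Rule.atom (.rght C)) E ∈ R) (h : B R njBias 0 (.expr E ::ₘ Δ)) :
    B R njBias 0 (Δ + {.expr (.atom (.rght C))}) := by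
  refine B.decide_one hr ?_
  rw [add_comm]
  exact B.mapsto_one (B.init (E := .atom (TAtom.rght C))) h

/-- Decide on a rule `lft A ↦ E` when `lft A` can be paid for. -/
theorem B.decide_lft {R : Set (Rule TAtom)} {Γ : Multiset Form} {A : Form} {E : Expr TAtom}
    {Δ : Multiset (RElem TAtom)}
    (hr : Rule.mapsto (Rule.atom (.lft A)) E ∈ R)
    (hA : B R njBias 0 (lftCtx Γ + {.debt (.lft A)})) (h : B R njBias 0 (.expr E ::ₘ Δ)) :
    B R njBias 0 (lftCtx Γ + Δ) :=
  B.decide_one hr (B.mapsto_one (B.debit_lft hA) h)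

theorem B.initd_lft {R : Set (Rule TAtom)} (A : Form) :
    B R njBias 0 (.expr (.atom (.lft A)) ::ₘ {.debt (.lft A)}) := by
  have h : B R njBias 0 {RElem.debt (.lft A), .expr (.atom (.lft A))} := B.initd
  rwa [Multiset.pair_comm] at h

/-- The encoding of a judgment of bidirectional natural deduction. -/
def encJudgment (Γ : Finset Form) (C : Form) : Bool → Multiset (RElem TAtom)
  | true => encUp Γ C
  | false => encDown Γ C

theorem NJn.toB {Γ : Finset Form} {C : Form} {d : Bool} (h : NJn Γ C d) :
    B Rnj' njBias 0 (encJudgment Γ C d) := by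
  induction h with
  | @impE Γ A C _ _ ih₁ ih₂ =>
    refine B.decide_one ⟨InRnj.impL A C, by simp⟩ ?_
    refine B.lbigMapsto (Γ := 0) (ups_lftCtx Γ.val) ?_ (B.initd_lft C)
    have h : B Rnj' njBias _ (lftCtx Γ.val + lftCtx Γ.val) :=
      B.mapsto_one (E := .atom (.rght A)) (B.debit_lft ih₁)
        (by rw [← Multiset.singleton_add, add_comm]; exact ih₂)
    have h' := B.contract_lftCtx (Δ := 0) (by rwa [add_zero])
    rwa [add_zero] at h'
  | @impI Γ A C _ ih =>
    refine B.decide_rght ⟨InRnj.impR A C, by simp⟩ (B.rtimes ?_)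
    have ih : B Rnj' njBias 0 (lftCtx (insert A Γ).val + {.expr (.atom (.rght C))}) := ih
    by_cases hA : A ∈ Γ
    · refine B.weakR (inClassical_lft A) ?_
      rw [Finset.insert_eq_of_mem hA] at ih
      rwa [← Multiset.singleton_add, add_comm]
    · rw [Finset.insert_val_of_notMem hA, lftCtx_cons, Multiset.cons_add, add_comm,
        Multiset.singleton_add] at ih
      exact ih
  | @andE1 Γ A C _ ih =>
    exact B.decide_lft ⟨InRnj.andL1 A C, by simp⟩ ih (B.initd_lft A)
  | @andE2 Γ A C _ ih =>
    exact B.decide_lft ⟨InRnj.andL2 A C, by simp⟩ ih (B.initd_lft C)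
  | @andI Γ A C _ _ ih₁ ih₂ =>
    refine B.decide_rght ⟨InRnj.andR A C, by simp⟩ (B.rplus ?_ ?_)
    · rw [← Multiset.singleton_add, add_comm]; exact ih₁
    · rw [← Multiset.singleton_add, add_comm]; exact ih₂
  | @id Γ A hA =>
    obtain ⟨Δ, hΔ⟩ := Multiset.exists_cons_of_mem (show A ∈ Γ.val from hA)
    have h := B.weaken_lftCtx (B.initd_lft (R := Rnj') A) Δ
    rw [Multiset.add_cons, ← Multiset.cons_add, ← lftCtx_cons, ← hΔ] at h
    exact h
  | @M Γ A _ ih =>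
    exact B.decide_one ⟨InRnj.id1 A, by simp⟩
      (B.ltimes (Γ1 := 0) (Γ2 := 0) (B.debit_lft ih) (B.init (E := .atom (TAtom.rght A))))
  | topI => exact B.decide_rght ⟨InRnj.topR, by simp⟩ (B.rzero _ _)
  | botE _ ih => exact B.decide_lft ⟨InRnj.botL, by simp⟩ ih (B.rzero _ _)

/-! ### A Kripke model made of normal derivations -/

theorem NJn.mono {Γ Γ' : Finset Form} {C : Form} {d : Bool} (h : NJn Γ C d) (hs : Γ ⊆ Γ') :
    NJn Γ' C d := by
  induction h generalizing Γ' with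
  | impE _ _ ih₁ ih₂ => exact .impE (ih₁ hs) (ih₂ hs)
  | impI _ ih => exact .impI (ih (Finset.insert_subset_insert _ hs))
  | andE1 _ ih => exact .andE1 (ih hs)
  | andE2 _ ih => exact .andE2 (ih hs)
  | andI _ _ ih₁ ih₂ => exact .andI (ih₁ hs) (ih₂ hs)
  | id hA => exact .id (hs hA)
  | M _ ih => exact .M (ih hs)
  | topI => exact .topI
  | botE _ ih => exact .botE (ih hs)

/-- Forcing in the Kripke model whose worlds are contexts, ordered by inclusion. Worlds in which
`⊥` has a neutral derivation force every formula. -/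
def Forces : Finset Form → Form → Prop
  | w, .atom n => NJn w (.atom n) true
  | w, .imp A C => ∀ w', w ⊆ w' → Forces w' A → Forces w' C
  | w, .and A C => Forces w A ∧ Forces w C
  | w, .or A C => Forces w A ∨ Forces w C
  | _, .top => True
  | w, .bot => NJn w .bot false

theorem Forces.mono {w w' : Finset Form} {A : Form} (h : Forces w A) (hs : w ⊆ w') :
    Forces w' A := by
  induction A with
  | atom n => exact NJn.mono h hs
  | imp A C _ _ => exact fun v hv hA => h v (hs.trans hv) hA
  | and A C ihA ihC => exact ⟨ihA h.1, ihC h.2⟩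
  | or A C ihA ihC => exact h.imp ihA ihC
  | top => trivial
  | bot => exact NJn.mono h hs

theorem Forces.of_bot {w : Finset Form} (h : Forces w .bot) (A : Form) : Forces w A := by
  induction A generalizing w with
  | atom n => exact NJn.botE h
  | imp A C _ ihC => exact fun v hv _ => ihC (h.mono hv)
  | and A C ihA ihC => exact ⟨ihA h, ihC h⟩
  | or A C ihA _ => exact .inl (ihA h)
  | top => trivial
  | bot => exact h

theorem forces_reflect_reify {A : Form} (hA : OrFree A) (w : Finset Form) :
    (NJn w A false → Forces w A) ∧ (Forces w A → NJn w A true) := by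
  induction A generalizing w with
  | atom n => exact ⟨NJn.M, fun h => h⟩
  | imp A C ihA ihC =>
    refine ⟨fun h v hv hv' => (ihC hA.2 v).1 ((h.mono hv).impE ((ihA hA.1 v).2 hv')), fun h => ?_⟩
    refine NJn.impI ((ihC hA.2 _).2 (h _ (Finset.subset_insert _ _) ?_))
    exact (ihA hA.1 _).1 (NJn.id (Finset.mem_insert_self _ _))
  | and A C ihA ihC =>
    exact ⟨fun h => ⟨(ihA hA.1 w).1 h.andE1, (ihC hA.2 w).1 h.andE2⟩,
      fun h => ((ihA hA.1 w).2 h.1).andI ((ihC hA.2 w).2 h.2)⟩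
  | or A C _ _ => exact hA.elim
  | top => exact ⟨fun _ => trivial, fun _ => .topI⟩
  | bot => exact ⟨fun h => h, NJn.botE⟩

/-- `C` is forced wherever all of `Γ` is. -/
def Entails (Γ : Multiset Form) (C : Form) : Prop :=
  ∀ w, (∀ A ∈ Γ, Forces w A) → Forces w C

theorem Entails.toNJn {Γ : Finset Form} {C : Form} (hΓ : ∀ A ∈ Γ, OrFree A) (hC : OrFree C)
    (h : Entails Γ.val C) : NJn Γ C true :=
  (forces_reflect_reify hC Γ).2
    (h Γ fun A hA => (forces_reflect_reify (hΓ A hA) Γ).1 (NJn.id hA))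

/-! ### Phase semantics for `B` -/

/-- Elements of the phase space: a multiset of hypotheses and a multiset of conclusions. -/
abbrev Phase : Type := Multiset Form × Multiset Form

/-- The pole: every single-conclusion element in it is a valid entailment. -/
def pole : Set Phase := {m | ∀ C, m.2 = {C} → Entails m.1 C}

/-- The orthogonal of a set with respect to the pole. -/
def orth (X : Set Phase) : Set Phase := {m | ∀ x ∈ X, m + x ∈ pole}

theorem mem_orth_singleton {m x : Phase} : m ∈ orth {x} ↔ m + x ∈ pole := by simp [orth]

/-- The element testing a tagged atom. -/
def atomTest : TAtom → Phase
  | .lft A => ({A}, 0)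
  | .rght A => (0, {A})

/-- The tests of an expression on the right. -/
def exprTests : Expr TAtom → Set Phase
  | .atom a => {atomTest a}
  | .zero => ∅
  | .one => {0}
  | .plus E₁ E₂ => exprTests E₁ ∪ exprTests E₂
  | .times E₁ E₂ => exprTests E₁ + exprTests E₂

/-- The tests of an element of the right-hand side. -/
def relemTests : RElem TAtom → Set Phase
  | .expr E => exprTests E
  | .debt a => orth {atomTest a}

/-- The interpretation of a rule on the left. -/
def ruleSem : Rule TAtom → Set Phase
  | .atom a => orth {atomTest a}
  | .zero => Set.univ
  | .one => pole
  | .plus r₁ r₂ => ruleSem r₁ ∩ ruleSem r₂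
  | .times r₁ r₂ => orth (orth (ruleSem r₁) + orth (ruleSem r₂))
  | .mapsto r E => orth (orth (ruleSem r) + orth (exprTests E))
  | .bigMapsto r E => orth ((orth (ruleSem r) ∩ {m | m.2 = 0}) + orth (exprTests E))

/-- Validity of a sequent in the phase space. -/
def Valid (G : Multiset (Rule TAtom)) (Δ : Multiset (RElem TAtom)) : Prop :=
  (G.map ruleSem).sum + (Δ.map relemTests).sum ⊆ pole

theorem ruleSem_toRule_subset (E : Expr TAtom) : ruleSem E.toRule ⊆ orth (exprTests E) := by
  induction E with
  | atom a => exact subset_rfl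
  | zero => intro m _ x hx; exact hx.elim
  | one => intro m hm x hx; obtain rfl : x = 0 := hx; rw [add_zero]; exact hm
  | plus E₁ E₂ ih₁ ih₂ =>
    intro m hm x hx
    exact hx.elim (ih₁ hm.1 x) (ih₂ hm.2 x)
  | times E₁ E₂ ih₁ ih₂ =>
    rintro m hm _ ⟨x, hx, y, hy, rfl⟩
    refine hm _ (Set.add_mem_add (fun z hz => ?_) (fun z hz => ?_))
    · rw [add_comm]; exact ih₁ hz x hx
    · rw [add_comm]; exact ih₂ hz y hy

theorem relemTests_of_ups {Υ : Multiset (RElem TAtom)} (h : Ups njBias Υ) {m : Phase}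
    (hm : m ∈ (Υ.map relemTests).sum) : m.2 = 0 := by
  induction Υ using Multiset.induction_on generalizing m with
  | empty =>
    obtain rfl : m = 0 := by simpa using hm
    rfl
  | cons x Υ ih =>
    rw [Multiset.map_cons, Multiset.sum_cons] at hm
    obtain ⟨y, hy, z, hz, rfl⟩ := hm
    obtain ⟨a, rfl, ha⟩ := h x (Multiset.mem_cons_self _ _)
    have hz0 := ih (fun u hu => h u (Multiset.mem_cons_of_mem hu)) hz
    obtain rfl : y = atomTest a := hy
    cases a with
    | lft A => simpa [atomTest] using hz0
    | rght A => simp [InClassical, njBias] at ha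

theorem pole_congr {Γ Γ' Δ : Multiset Form} (h : ∀ A, A ∈ Γ → A ∈ Γ')
    (hm : ((Γ, Δ) : Phase) ∈ pole) : ((Γ', Δ) : Phase) ∈ pole :=
  fun C hC w hw => hm C hC w fun A hA => hw A (h A hA)

/-- A rule `a ↦ E` is valid as soon as the tests of `E` are at least as strong as that of `a`. -/
theorem zero_mem_ruleSem_mapsto {a : TAtom} {E : Expr TAtom}
    (h : orth (exprTests E) ⊆ orth {atomTest a}) :
    (0 : Phase) ∈ ruleSem (.mapsto (.atom a) E) := by
  rintro _ ⟨y, hy, x, hx, rfl⟩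
  rw [zero_add]
  exact hy x (h hx)

theorem eq_zero_of_add_singleton {Δ : Multiset Form} {A C : Form} (h : Δ + {A} = {C}) :
    Δ = 0 ∧ A = C := by
  have hc : Δ = 0 := by
    have := congrArg Multiset.card h
    simpa using this
  subst hc
  exact ⟨rfl, by simpa using h⟩

theorem zero_mem_ruleSem_impL (A C : Form) : (0 : Phase) ∈ ruleSem (.bigMapsto
    (.mapsto (.atom (.lft (A.imp C))) (.atom (.rght A))) (.atom (.lft C))) := by
  rintro _ ⟨⟨Υ, Υ'⟩, ⟨hy, rfl : Υ' = 0⟩, ⟨Γ, Δ⟩, hx, rfl⟩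
  have hC : ((0, {C}) : Phase) ∈ ruleSem
      (.mapsto (.atom (.lft (A.imp C))) (.atom (.rght A))) := by
    rintro _ ⟨v, hv, ⟨Θ, Δ'⟩, hu, rfl⟩
    have key : ((Θ, Δ' + {C}) : Phase) ∈ orth {atomTest (.lft (A.imp C))} := by
      refine mem_orth_singleton.2 fun D hD w hw => ?_
      obtain ⟨rfl, rfl⟩ := eq_zero_of_add_singleton (show Δ' + {C} = {D} by
        simpa [atomTest] using hD)
      have hA := mem_orth_singleton.1 hu A (by simp [atomTest]) w
        fun F hF => hw F (by simp [atomTest] at hF ⊢; exact .inl hF)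
      exact hw (A.imp C) (by simp [atomTest]) w subset_rfl hA
    have := hv _ key
    convert this using 1
    ext1 <;> simp [add_comm, add_left_comm, add_assoc]
  have h₁ : Entails Υ C := fun w hw => hy _ hC C (by simp) w (by simpa using hw)
  intro D hD w hw
  have hx' := mem_orth_singleton.1 hx D (by simpa [atomTest] using hD) w
  refine hx' fun F hF => ?_
  rcases Multiset.mem_add.1 hF with hF | hF
  · exact hw F (by simp [hF])
  · obtain rfl := Multiset.mem_singleton.1 hF
    exact h₁ w fun G hG => hw G (by simp [hG])

theorem orth_lft_subset {A C : Form} (h : ∀ w, Forces w A → Forces w C) :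
    orth {atomTest (.lft C)} ⊆ orth {atomTest (.lft A)} := by
  rintro ⟨Γ, Δ⟩ hx
  refine mem_orth_singleton.2 fun D hD w hw => ?_
  refine mem_orth_singleton.1 hx D hD w fun F hF => ?_
  rcases Multiset.mem_add.1 hF with hF | hF
  · exact hw F (Multiset.mem_add.2 (.inl hF))
  · obtain rfl := Multiset.mem_singleton.1 hF
    exact h w (hw A (Multiset.mem_add.2 (.inr (Multiset.mem_singleton_self _))))

theorem orth_rght_subset {A C : Form} (h : ∀ w, Forces w A → Forces w C) :
    orth {atomTest (.rght A)} ⊆ orth {atomTest (.rght C)} := by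
  rintro ⟨Γ, Δ⟩ hx
  refine mem_orth_singleton.2 fun D hD w hw => ?_
  obtain ⟨rfl, rfl⟩ := eq_zero_of_add_singleton hD
  exact h w (mem_orth_singleton.1 hx A (by simp [atomTest]) w hw)

theorem zero_mem_ruleSem {r : Rule TAtom} (hr : r ∈ Rnj') : (0 : Phase) ∈ ruleSem r := by
  obtain ⟨hr, hid⟩ := hr
  cases hr with
  | impL A C => exact zero_mem_ruleSem_impL A C
  | impR A C =>
    refine zero_mem_ruleSem_mapsto ?_
    rintro ⟨Γ, Δ⟩ hx
    refine mem_orth_singleton.2 fun D hD w hw => ?_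
    obtain ⟨rfl, rfl⟩ := eq_zero_of_add_singleton hD
    intro v hv hA
    refine hx _ (Set.add_mem_add rfl rfl) C (by simp [atomTest]) v fun F hF => ?_
    simp only [atomTest, Prod.mk_add_mk, add_zero, Multiset.mem_add,
      Multiset.mem_singleton] at hF hw
    rcases hF with hF | rfl
    · exact (hw F hF).mono hv
    · exact hA
  | andL1 A C => exact zero_mem_ruleSem_mapsto (orth_lft_subset fun _ h => h.1)
  | andL2 A C => exact zero_mem_ruleSem_mapsto (orth_lft_subset fun _ h => h.2)
  | andR A C =>
    refine zero_mem_ruleSem_mapsto ?_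
    rintro ⟨Γ, Δ⟩ hx
    refine mem_orth_singleton.2 fun D hD w hw => ?_
    obtain ⟨rfl, rfl⟩ := eq_zero_of_add_singleton hD
    exact ⟨hx _ (.inl rfl) A (by simp [atomTest]) w hw,
      hx _ (.inr rfl) C (by simp [atomTest]) w hw⟩
  | orL A C =>
    refine zero_mem_ruleSem_mapsto ?_
    rintro ⟨Γ, Δ⟩ hx
    refine mem_orth_singleton.2 fun D hD w hw => ?_
    have hΓ : ∀ F ∈ Γ, Forces w F := fun F hF => hw F (Multiset.mem_add.2 (.inl hF))
    have hor : Forces w (A.or C) :=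
      hw _ (Multiset.mem_add.2 (.inr (Multiset.mem_singleton_self _)))
    rcases hor with h | h
    · refine hx _ (.inl rfl) D hD w fun F hF => (Multiset.mem_add.1 hF).elim (hΓ F) fun hF => ?_
      obtain rfl := Multiset.mem_singleton.1 hF
      exact h
    · refine hx _ (.inr rfl) D hD w fun F hF => (Multiset.mem_add.1 hF).elim (hΓ F) fun hF => ?_
      obtain rfl := Multiset.mem_singleton.1 hF
      exact h
  | orR1 A C => exact zero_mem_ruleSem_mapsto (orth_rght_subset fun _ h => .inl h)
  | orR2 A C => exact zero_mem_ruleSem_mapsto (orth_rght_subset fun _ h => .inr h)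
  | botL =>
    refine zero_mem_ruleSem_mapsto fun x _ => mem_orth_singleton.2 fun D _ w hw => ?_
    have hbot : Forces w .bot := hw _ (by simp [atomTest])
    exact hbot.of_bot D
  | topR =>
    refine zero_mem_ruleSem_mapsto ?_
    rintro ⟨Γ, Δ⟩ -
    refine mem_orth_singleton.2 fun D hD w _ => ?_
    obtain ⟨rfl, rfl⟩ := eq_zero_of_add_singleton hD
    trivial
  | id1 C =>
    rintro _ ⟨y, hy, z, hz, rfl⟩
    rw [zero_add]
    change y + z ∈ pole
    rw [add_comm]
    refine hz y (mem_orth_singleton.2 (hy _ (mem_orth_singleton.2 ?_)))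
    intro D hD w hw
    obtain rfl : C = D := by simpa [atomTest] using hD
    exact hw C (by simp [atomTest])
  | id2 C => exact (hid C rfl).elim

theorem zero_mem_sum_ruleSem {G : Multiset (Rule TAtom)} (hG : ∀ r ∈ G, r ∈ Rnj') :
    (0 : Phase) ∈ (G.map ruleSem).sum := by
  induction G using Multiset.induction_on with
  | empty => simp
  | cons r G ih =>
    rw [Multiset.map_cons, Multiset.sum_cons]
    exact ⟨0, zero_mem_ruleSem (hG r (Multiset.mem_cons_self _ _)), 0,
      ih fun r' hr' => hG r' (Multiset.mem_cons_of_mem hr'), add_zero 0⟩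

theorem atomTest_contract {S : TAtom} (hS : InClassical njBias S) {m : Phase}
    (h : atomTest S + (atomTest S + m) ∈ pole) : atomTest S + m ∈ pole := by
  cases S with
  | lft A =>
    obtain ⟨Γ, Δ⟩ := m
    simp only [atomTest, Prod.mk_add_mk, zero_add] at h ⊢
    exact pole_congr (fun F hF => by simpa using hF) h
  | rght A => simp [InClassical, njBias] at hS

theorem atomTest_weaken {S : TAtom} (hS : InClassical njBias S) {m : Phase}
    (h : m ∈ pole) : atomTest S + m ∈ pole := by
  cases S with
  | lft A =>
    obtain ⟨Γ, Δ⟩ := m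
    simp only [atomTest, Prod.mk_add_mk, zero_add]
    exact pole_congr (fun F hF => by simp [hF]) h
  | rght A => simp [InClassical, njBias] at hS

theorem valid_iff {G : Multiset (Rule TAtom)} {Δ : Multiset (RElem TAtom)} :
    Valid G Δ ↔ ∀ g ∈ (G.map ruleSem).sum, ∀ t ∈ (Δ.map relemTests).sum, g + t ∈ pole :=
  Set.add_subset_iff

theorem valid_cons_right {G : Multiset (Rule TAtom)} {x : RElem TAtom}
    {Δ : Multiset (RElem TAtom)} : Valid G (x ::ₘ Δ) ↔
      ∀ g ∈ (G.map ruleSem).sum, ∀ s ∈ relemTests x, ∀ t ∈ (Δ.map relemTests).sum,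
        g + (s + t) ∈ pole := by
  simp only [valid_iff, Multiset.map_cons, Multiset.sum_cons, Set.mem_add]
  exact ⟨fun h g hg s hs t ht => h g hg _ ⟨s, hs, t, ht, rfl⟩,
    fun h g hg _ ⟨s, hs, t, ht, e⟩ => e ▸ h g hg s hs t ht⟩

theorem valid_cons_left {G : Multiset (Rule TAtom)} {r : Rule TAtom}
    {Δ : Multiset (RElem TAtom)} : Valid (r ::ₘ G) Δ ↔
      ∀ m ∈ ruleSem r, ∀ g ∈ (G.map ruleSem).sum, ∀ t ∈ (Δ.map relemTests).sum,
        m + (g + t) ∈ pole := by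
  simp only [valid_iff, Multiset.map_cons, Multiset.sum_cons, Set.mem_add]
  exact ⟨fun h m hm g hg t ht => add_assoc m g t ▸ h _ ⟨m, hm, g, hg, rfl⟩ t ht,
    fun h _ ⟨m, hm, g, hg, e⟩ t ht => e ▸ (add_assoc m g t).symm ▸ h m hm g hg t ht⟩

theorem Valid.left_mem_orth {G : Multiset (Rule TAtom)} {r : Rule TAtom}
    {Δ : Multiset (RElem TAtom)} (h : Valid (r ::ₘ G) Δ) {g t : Phase}
    (hg : g ∈ (G.map ruleSem).sum) (ht : t ∈ (Δ.map relemTests).sum) :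
    g + t ∈ orth (ruleSem r) :=
  fun m hm => by rw [add_comm]; exact valid_cons_left.1 h m hm g hg t ht

theorem Valid.right_mem_orth {G : Multiset (Rule TAtom)} {E : Expr TAtom}
    {Δ : Multiset (RElem TAtom)} (h : Valid G (.expr E ::ₘ Δ)) {g t : Phase}
    (hg : g ∈ (G.map ruleSem).sum) (ht : t ∈ (Δ.map relemTests).sum) :
    g + t ∈ orth (exprTests E) :=
  fun s hs => by
    rw [add_assoc, add_comm t s]
    exact valid_cons_right.1 h g hg s hs t ht

theorem mem_pole_of_split {X Y : Set Phase} {m g₁ g₂ t₁ t₂ : Phase} (hm : m ∈ orth (X + Y))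
    (hX : g₁ + t₁ ∈ X) (hY : g₂ + t₂ ∈ Y) : m + (g₁ + g₂ + (t₁ + t₂)) ∈ pole := by
  rw [add_add_add_comm]
  exact hm _ (Set.add_mem_add hX hY)

theorem B.valid {G : Multiset (Rule TAtom)} {Δ : Multiset (RElem TAtom)}
    (h : B Rnj' njBias G Δ) : Valid G Δ := by
  induction h with
  | rzero => exact valid_cons_right.2 fun _ _ _ hs => hs.elim
  | rplus _ _ ih₁ ih₂ =>
    refine valid_cons_right.2 fun g hg s hs t ht => ?_
    exact hs.elim (fun hs => valid_cons_right.1 ih₁ g hg s hs t ht)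
      (fun hs => valid_cons_right.1 ih₂ g hg s hs t ht)
  | rone _ ih =>
    refine valid_cons_right.2 fun g hg s hs t ht => ?_
    obtain rfl : s = 0 := hs
    rw [zero_add]
    exact valid_iff.1 ih g hg t ht
  | rtimes _ ih =>
    refine valid_cons_right.2 ?_
    rintro g hg _ ⟨s₁, hs₁, s₂, hs₂, rfl⟩ t ht
    have := valid_cons_right.1 ih g hg s₁ hs₁ (s₂ + t)
      (by rw [Multiset.map_cons, Multiset.sum_cons]; exact Set.add_mem_add hs₂ ht)
    rwa [← add_assoc s₁] at this
  | lone =>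
    refine valid_iff.2 fun g hg t ht => ?_
    obtain rfl : t = 0 := by simpa using ht
    simpa [ruleSem] using hg
  | lplusL _ ih =>
    exact valid_cons_left.2 fun m hm => valid_cons_left.1 ih m hm.1
  | lplusR _ ih =>
    exact valid_cons_left.2 fun m hm => valid_cons_left.1 ih m hm.2
  | ltimes _ _ ih₁ ih₂ =>
    refine valid_cons_left.2 fun m hm g hg t ht => ?_
    rw [Multiset.map_add, Multiset.sum_add] at hg ht
    obtain ⟨g₁, hg₁, g₂, hg₂, rfl⟩ := hg
    obtain ⟨t₁, ht₁, t₂, ht₂, rfl⟩ := ht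
    exact mem_pole_of_split hm (ih₁.left_mem_orth hg₁ ht₁) (ih₂.left_mem_orth hg₂ ht₂)
  | lmapsto _ _ ih₁ ih₂ =>
    refine valid_cons_left.2 fun m hm g hg t ht => ?_
    rw [Multiset.map_add, Multiset.sum_add] at hg ht
    obtain ⟨g₁, hg₁, g₂, hg₂, rfl⟩ := hg
    obtain ⟨t₁, ht₁, t₂, ht₂, rfl⟩ := ht
    exact mem_pole_of_split hm (ih₁.left_mem_orth hg₁ ht₁) (ih₂.right_mem_orth hg₂ ht₂)
  | lbigMapsto hΥ _ _ ih₁ ih₂ =>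
    refine valid_cons_left.2 fun m hm g hg t ht => ?_
    rw [Multiset.map_add, Multiset.sum_add] at ht
    obtain ⟨t₁, ht₁, t₂, ht₂, rfl⟩ := ht
    have h₁ := Valid.left_mem_orth (G := 0) ih₁ (g := 0) (by simp) ht₁
    have := mem_pole_of_split (g₁ := 0) hm ⟨h₁, by simpa using relemTests_of_ups hΥ ht₁⟩
      (ih₂.right_mem_orth hg ht₂)
    rwa [zero_add] at this
  | @decide G Δ _ hG _ ih =>
    refine valid_iff.2 fun g hg t ht => valid_iff.1 ih g ?_ t ht
    obtain rfl : g = 0 := by simpa using hg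
    exact zero_mem_sum_ruleSem hG
  | debit1 _ _ ih =>
    refine valid_cons_left.2 fun m hm g hg t ht => ?_
    rw [add_left_comm]
    exact valid_cons_right.1 ih g hg m hm t ht
  | debit2 _ _ _ ih =>
    refine valid_iff.2 fun m hm t ht => ?_
    have := valid_cons_right.1 ih 0 (by simp) m
      (by rw [Multiset.map_singleton, Multiset.sum_singleton] at hm; exact hm) t ht
    rwa [zero_add] at this
  | @init E =>
    refine valid_iff.2 fun m hm t ht => ?_
    rw [Multiset.map_singleton, Multiset.sum_singleton] at hm ht
    exact ruleSem_toRule_subset E hm t ht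
  | initd =>
    refine valid_cons_right.2 fun g hg s hs t ht => ?_
    obtain rfl : g = 0 := by simpa using hg
    rw [zero_add]
    rw [Multiset.map_singleton, Multiset.sum_singleton] at ht
    exact hs t ht
  | contrR hS _ ih =>
    refine valid_cons_right.2 fun g hg s hs t ht => ?_
    obtain rfl := hs
    rw [add_left_comm]
    refine atomTest_contract hS ?_
    have := valid_cons_right.1 ih g hg _ rfl _
      (by rw [Multiset.map_cons, Multiset.sum_cons]; exact Set.add_mem_add rfl ht)
    convert this using 1
    abel
  | weakR hS _ ih =>
    refine valid_cons_right.2 fun g hg s hs t ht => ?_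
    obtain rfl := hs
    rw [add_left_comm]
    exact atomTest_weaken hS (valid_iff.1 ih g hg t ht)

theorem sum_relemTests_lftCtx (Γ : Multiset Form) :
    ((Γ, 0) : Phase) ∈ ((lftCtx Γ).map relemTests).sum := by
  induction Γ using Multiset.induction_on with
  | empty => simp [lftCtx]
  | cons A Γ ih =>
    rw [lftCtx_cons, Multiset.map_cons, Multiset.sum_cons]
    exact ⟨({A}, 0), rfl, _, ih, by simp⟩

theorem Entails.of_B {Γ : Finset Form} {C : Form} (h : B Rnj' njBias 0 (encUp Γ C)) :
    Entails Γ.val C := by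
  have hv := valid_iff.1 h.valid 0 (by simp) (Γ.val, {C}) ?_
  · simpa using hv C (by simp)
  · rw [encUp, Multiset.map_add, Multiset.sum_add]
    exact ⟨_, sum_relemTests_lftCtx Γ.val, (0, {C}), by simp [relemTests, exprTests, atomTest],
      by simp⟩

/-- Normal natural deduction: in the ∨-free fragment, `Γ ⊢ C↑` has a normal NJ
derivation (no switch rule `[S]`) iff `⊢ lft(Γ), rght(C)` is `B`-provable from
`ℛ_nj \ {Id2}`: removing `Id2` exactly captures normal proofs. -/
theorem normal_nj_adequacy (Γ : Finset Form) (C : Form)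
    (hΓ : ∀ A ∈ Γ, OrFree A) (hC : OrFree C) :
    NJn Γ C true ↔ B Rnj' njBias 0 (encUp Γ C) :=
  ⟨fun h => h.toB, fun h => (Entails.of_B h).toNJn hΓ hC⟩
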